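/- Let n_{3,3} = V ⊕ ℝ^6 be a pseudo H-type Lie algebra built on a minimal admissible Cl_{3,3}-module. Then there does not exist a Lie algebra automorphism φ of n_{3,3} mapping the center ℝ^6 onto itself whose restriction to the center is an anti-isometry of the scalar product ⟨·,·⟩_{3,3}. -/

import Mathlib

/-- The standard scalar product of signature `(r,s)` on `ℝ^(r+s)`:
`⟨Z,W⟩_{r,s} = ∑_{i<r} Z i * W i - ∑_{r ≤ i < r+s} Z i * W i`. -/
def sform (r s : ℕ) (Z W : Fin (r + s) → ℝ) : ℝ :=
  ∑ i : Fin (r + s), (if (i : ℕ) < r then (1 : ℝ) else -1) * Z i * W i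

/-- `(V, B, J)` is an admissible module of the Clifford algebra `Cl_{r,s}`:
`V` is a nonzero finite-dimensional real vector space, `B` a nondegenerate
symmetric bilinear form on `V`, and `J : ℝ^{r+s} → End V` linear with
`J_Z ∘ J_Z = -⟨Z,Z⟩_{r,s} • id` and each `J_Z` skew-adjoint w.r.t. `B`. -/
def IsAdmissible (r s : ℕ) (V : Type) [AddCommGroup V] [Module ℝ V]
    (B : V →ₗ[ℝ] V →ₗ[ℝ] ℝ)
    (J : (Fin (r + s) → ℝ) →ₗ[ℝ] V →ₗ[ℝ] V) : Prop :=
  FiniteDimensional ℝ V ∧ Nontrivial V ∧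
  (∀ v w : V, B v w = B w v) ∧
  (∀ v : V, (∀ w : V, B v w = 0) → v = 0) ∧
  (∀ (Z : Fin (r + s) → ℝ) (v : V), J Z (J Z v) = (-(sform r s Z Z)) • v) ∧
  (∀ (Z : Fin (r + s) → ℝ) (v w : V), B (J Z v) w = -(B v (J Z w)))

/-- A minimal admissible `Cl_{r,s}`-module: one of least possible dimension. -/
def IsMinimalAdmissible (r s : ℕ) (V : Type) [AddCommGroup V] [Module ℝ V]
    (B : V →ₗ[ℝ] V →ₗ[ℝ] ℝ)
    (J : (Fin (r + s) → ℝ) →ₗ[ℝ] V →ₗ[ℝ] V) : Prop :=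
  IsAdmissible r s V B J ∧
  ∀ (V' : Type) [AddCommGroup V'] [Module ℝ V']
    (B' : V' →ₗ[ℝ] V' →ₗ[ℝ] ℝ)
    (J' : (Fin (r + s) → ℝ) →ₗ[ℝ] V' →ₗ[ℝ] V'),
    IsAdmissible r s V' B' J' → Module.finrank ℝ V ≤ Module.finrank ℝ V'

/-- `br` is the Lie bracket of the pseudo `H`-type Lie algebra `V ⊕ ℝ^{r+s}`
determined by the admissible module `(V,B,J)`, i.e.
`⟨Z, [v,w]⟩_{r,s} = ⟨J_Z v, w⟩_V` for all `Z, v, w`. -/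
def IsHBracket (r s : ℕ) (V : Type) [AddCommGroup V] [Module ℝ V]
    (B : V →ₗ[ℝ] V →ₗ[ℝ] ℝ)
    (J : (Fin (r + s) → ℝ) →ₗ[ℝ] V →ₗ[ℝ] V)
    (br : V →ₗ[ℝ] V →ₗ[ℝ] (Fin (r + s) → ℝ)) : Prop :=
  ∀ (Z : Fin (r + s) → ℝ) (v w : V), sform r s Z (br v w) = B (J Z v) w

/-- A linear equivalence `f` between the pseudo `H`-type Lie algebras
`V₁ ⊕ ℝ^{n₁}` and `V₂ ⊕ ℝ^{n₂}` (with 2-step brackets `br₁`, `br₂`, the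
`ℝ^{nᵢ}` factors being central) is a Lie algebra isomorphism. -/
def IsLieIso {V₁ : Type} [AddCommGroup V₁] [Module ℝ V₁]
    {V₂ : Type} [AddCommGroup V₂] [Module ℝ V₂] {n₁ n₂ : ℕ}
    (br₁ : V₁ →ₗ[ℝ] V₁ →ₗ[ℝ] (Fin n₁ → ℝ))
    (br₂ : V₂ →ₗ[ℝ] V₂ →ₗ[ℝ] (Fin n₂ → ℝ))
    (f : (V₁ × (Fin n₁ → ℝ)) ≃ₗ[ℝ] (V₂ × (Fin n₂ → ℝ))) : Prop :=
  ∀ x y : V₁ × (Fin n₁ → ℝ),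
    f (0, br₁ x.1 y.1) = (0, br₂ (f x).1 (f y).1)

/-- The alternating `4 × 4` matrix with upper triangular entries `a, b, c, d, e, f`, as a map. -/
def altMap (a b c d e f : ℝ) : (Fin 4 → ℝ) →ₗ[ℝ] (Fin 4 → ℝ) :=
  Matrix.mulVecLin !![0, a, b, c; -a, 0, d, e; -b, -d, 0, f; -c, -e, -f, 0]

/-- The Clifford action of `ℝ^{3,3}` on `ℝ⁴ ⊕ ℝ⁴`: a vector corresponds to an alternating matrix
whose Pfaffian is the quadratic form, acting together with its Pfaffian adjoint. -/
def spinorAction : (Fin (3 + 3) → ℝ) →ₗ[ℝ]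
    ((Fin 4 → ℝ) × (Fin 4 → ℝ)) →ₗ[ℝ] ((Fin 4 → ℝ) × (Fin 4 → ℝ)) :=
  LinearMap.mk₂ ℝ
    (fun Z x =>
      (altMap (Z 2 - Z 5) (Z 1 - Z 4) (Z 0 - Z 3) (Z 0 + Z 3) (-(Z 1 + Z 4)) (Z 2 + Z 5) x.2,
        altMap (Z 2 + Z 5) (Z 1 + Z 4) (Z 0 + Z 3) (Z 0 - Z 3) (-(Z 1 - Z 4)) (Z 2 - Z 5) x.1))
    (by
      intro Z W x
      ext i <;> fin_cases i <;> simp [altMap, Matrix.mulVec, dotProduct, Fin.sum_univ_four] <;> ring)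
    (by
      intro c Z x
      ext i <;> fin_cases i <;> simp [altMap, Matrix.mulVec, dotProduct, Fin.sum_univ_four] <;> ring)
    (by intro Z x y; simp)
    (by intro c Z x; simp)

/-- The neutral pairing on `ℝ⁴ ⊕ ℝ⁴`. -/
def spinorForm : ((Fin 4 → ℝ) × (Fin 4 → ℝ)) →ₗ[ℝ] ((Fin 4 → ℝ) × (Fin 4 → ℝ)) →ₗ[ℝ] ℝ :=
  LinearMap.mk₂ ℝ (fun x y => x.1 ⬝ᵥ y.2 + x.2 ⬝ᵥ y.1)
    (by intro x y z; simp [add_dotProduct]; ring)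
    (by intro c x y; simp; ring)
    (by intro x y z; simp [dotProduct_add]; ring)
    (by intro c x y; simp; ring)

theorem isAdmissible_spinor :
    IsAdmissible 3 3 ((Fin 4 → ℝ) × (Fin 4 → ℝ)) spinorForm spinorAction := by
  refine ⟨inferInstance, inferInstance, ?_, ?_, ?_, ?_⟩
  · intro v w
    simp only [spinorForm, LinearMap.mk₂_apply]
    rw [dotProduct_comm v.1, dotProduct_comm v.2, add_comm]
  · intro v h
    ext i
    · simpa [spinorForm] using h (0, Pi.single i 1)
    · simpa [spinorForm] using h (Pi.single i 1, 0)
  · intro Z v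
    ext i <;> fin_cases i <;>
      simp [spinorAction, altMap, sform, dotProduct, Fin.sum_univ_succ] <;> ring
  · intro Z v w
    simp [spinorAction, spinorForm, altMap, dotProduct, Fin.sum_univ_four]
    ring

section Clifford

variable {V : Type*} [AddCommGroup V] [Module ℝ V]

/-- The `1`-eigenspace of `a` in `W` has at most half the dimension of `W` when an involution
preserving `W` anticommutes with `a`. -/
theorem two_mul_finrank_inf_eqLocus_le [FiniteDimensional ℝ V] (W : Submodule ℝ V)
    (a j : V →ₗ[ℝ] V) (hj : ∀ v, j (j v) = v) (hja : ∀ v, a (j v) = -j (a v))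
    (hW : ∀ v ∈ W, j v ∈ W) :
    2 * Module.finrank ℝ ↥(W ⊓ LinearMap.eqLocus a LinearMap.id) ≤ Module.finrank ℝ W := by
  set X := W ⊓ LinearMap.eqLocus a LinearMap.id with hX
  have hinj : Function.Injective j := Function.LeftInverse.injective hj
  have hle : X ⊔ X.map j ≤ W := by
    refine sup_le inf_le_left ?_
    rintro _ ⟨v, hv, rfl⟩
    exact hW v hv.1
  have hdisj : X ⊓ X.map j = ⊥ := by
    rw [eq_bot_iff]
    rintro _ ⟨hv, u, hu, rfl⟩
    have h1 : a (j u) = j u := hv.2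
    have h2 : a u = u := hu.2
    rw [hja, h2] at h1
    rw [neg_eq_iff_add_eq_zero, ← two_smul ℝ] at h1
    exact (smul_eq_zero.mp h1).resolve_left two_ne_zero
  have h1 := Submodule.finrank_sup_add_finrank_inf_eq X (X.map j)
  rw [hdisj, finrank_bot, ← (Submodule.equivMapOfInjective j hinj X).finrank_eq] at h1
  have h2 := Submodule.finrank_mono hle
  omega

/-- If `a` is an involution anticommuting with the involution `j`, both preserving `W ≠ 0`, then
`a` fixes a nonzero vector of `W`. -/
theorem exists_fixed_ne_zero (W : Submodule ℝ V) (a j : V →ₗ[ℝ] V) (hj : ∀ v, j (j v) = v)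
    (ha : ∀ v, a (a v) = v) (hja : ∀ v, a (j v) = -j (a v)) (hWj : ∀ v ∈ W, j v ∈ W)
    (hWa : ∀ v ∈ W, a v ∈ W) (hW : ∃ v ∈ W, v ≠ 0) :
    ∃ v ∈ W ⊓ LinearMap.eqLocus a LinearMap.id, v ≠ 0 := by
  obtain ⟨v, hv, hv0⟩ := hW
  by_cases h : v + a v = 0
  · refine ⟨j v, ⟨hWj v hv, ?_⟩, fun h0 => hv0 (by rw [← hj v, h0, map_zero])⟩
    have : a v = -v := (neg_eq_of_add_eq_zero_right h).symm
    simp [hja, this]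
  · exact ⟨v + a v, ⟨W.add_mem hv (hWa v hv), by simp [ha, add_comm]⟩, h⟩

/-- In dimension at most `8`, six generators of the Clifford algebra of signature `(3,3)` that are
skew for a nondegenerate form admit no self-adjoint `P` with `P K P = -K` for each generator `K`. -/
theorem clifford_no_twist [FiniteDimensional ℝ V] [Nontrivial V] (hdim : Module.finrank ℝ V ≤ 8)
    (B : V →ₗ[ℝ] V →ₗ[ℝ] ℝ) (hB : ∀ v, (∀ w, B v w = 0) → v = 0)
    (K : Fin 6 → V →ₗ[ℝ] V)
    (hanti : ∀ i j, i < j → ∀ v, K j (K i v) = -K i (K j v))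
    (hpos : ∀ i, i < 3 → ∀ v, K i (K i v) = v)
    (hneg : ∀ i, 3 ≤ i → ∀ v, K i (K i v) = -v)
    (hskew : ∀ i v w, B (K i v) w = -B v (K i w))
    (P : V →ₗ[ℝ] V) (hP : ∀ v w, B (P v) w = B v (P w))
    (hPK : ∀ i v, P (K i (P v)) = -K i v) : False := by
  have comm : ∀ i j v, K i (K j (P v)) = P (K i (K j v)) := by
    intro i j v
    have h := hPK i (K j (P v))
    rw [hPK j v] at h
    simpa using h.symm
  let a : V →ₗ[ℝ] V := K 0 ∘ₗ K 3
  let b : V →ₗ[ℝ] V := K 1 ∘ₗ K 4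
  let c : V →ₗ[ℝ] V := K 2 ∘ₗ K 5
  have ha : ∀ v, a v = K 0 (K 3 v) := fun _ => rfl
  have hb : ∀ v, b v = K 1 (K 4 v) := fun _ => rfl
  have hc : ∀ v, c v = K 2 (K 5 v) := fun _ => rfl
  have s0 := hpos 0 (by decide)
  have s1 := hpos 1 (by decide)
  have s2 := hpos 2 (by decide)
  have s3 := hneg 3 (by decide)
  have s4 := hneg 4 (by decide)
  have s5 := hneg 5 (by decide)
  have t01 := hanti 0 1 (by decide)
  have t02 := hanti 0 2 (by decide)
  have t03 := hanti 0 3 (by decide)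
  have t04 := hanti 0 4 (by decide)
  have t05 := hanti 0 5 (by decide)
  have t12 := hanti 1 2 (by decide)
  have t13 := hanti 1 3 (by decide)
  have t14 := hanti 1 4 (by decide)
  have t15 := hanti 1 5 (by decide)
  have t23 := hanti 2 3 (by decide)
  have t24 := hanti 2 4 (by decide)
  have t25 := hanti 2 5 (by decide)
  have t34 := hanti 3 4 (by decide)
  have t35 := hanti 3 5 (by decide)
  have t45 := hanti 4 5 (by decide)
  have haa : ∀ v, a (a v) = v := fun v => by simp [ha, s0, s3, t03]
  have hbb : ∀ v, b (b v) = v := fun v => by simp [hb, s1, s4, t14]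
  have hcc : ∀ v, c (c v) = v := fun v => by simp [hc, s2, s5, t25]
  have hab : ∀ v, a (b v) = b (a v) := fun v => by simp [ha, hb, t01, t04, t13, t34]
  have hac : ∀ v, a (c v) = c (a v) := fun v => by simp [ha, hc, t02, t05, t23, t35]
  have hbc : ∀ v, b (c v) = c (b v) := fun v => by simp [hb, hc, t12, t15, t24, t45]
  have a0 : ∀ v, a (K 0 v) = -K 0 (a v) := fun v => by simp [ha, t03]
  have a1 : ∀ v, a (K 1 v) = K 1 (a v) := fun v => by simp [ha, t01, t13]
  have a2 : ∀ v, a (K 2 v) = K 2 (a v) := fun v => by simp [ha, t02, t23]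
  have b0 : ∀ v, b (K 0 v) = K 0 (b v) := fun v => by simp [hb, t01, t04]
  have b1 : ∀ v, b (K 1 v) = -K 1 (b v) := fun v => by simp [hb, t14]
  have b2 : ∀ v, b (K 2 v) = K 2 (b v) := fun v => by simp [hb, t12, t24]
  have c0 : ∀ v, c (K 0 v) = K 0 (c v) := fun v => by simp [hc, t02, t05]
  have c1 : ∀ v, c (K 1 v) = K 1 (c v) := fun v => by simp [hc, t12, t15]
  have c2 : ∀ v, c (K 2 v) = -K 2 (c v) := fun v => by simp [hc, t25]
  have skew2 : ∀ i j, i < j → ∀ v w, B (K i (K j v)) w = -B v (K i (K j w)) := by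
    intro i j hij v w
    rw [hskew, hskew, hanti i j hij]
    simp
  set W₁ := (⊤ : Submodule ℝ V) ⊓ LinearMap.eqLocus a LinearMap.id with hW₁
  set W₂ := W₁ ⊓ LinearMap.eqLocus b LinearMap.id with hW₂
  set W₃ := W₂ ⊓ LinearMap.eqLocus c LinearMap.id with hW₃
  have mem₁ : ∀ v, v ∈ W₁ ↔ a v = v := by simp [hW₁]
  have mem₂ : ∀ v, v ∈ W₂ ↔ a v = v ∧ b v = v := by simp [hW₂, mem₁]
  have mem₃ : ∀ v, v ∈ W₃ ↔ (a v = v ∧ b v = v) ∧ c v = v := by simp [hW₃, mem₂]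
  have hW₁1 : ∀ v ∈ W₁, K 1 v ∈ W₁ := fun v hv => by
    simp only [mem₁] at hv ⊢; rw [a1, hv]
  have hW₂2 : ∀ v ∈ W₂, K 2 v ∈ W₂ := fun v hv => by
    simp only [mem₂] at hv ⊢; rw [a2, b2, hv.1, hv.2]; simp
  have hfin : Module.finrank ℝ W₃ ≤ 1 := by
    have h1 := two_mul_finrank_inf_eqLocus_le ⊤ a (K 0) s0 a0 (fun _ _ => trivial)
    have h2 := two_mul_finrank_inf_eqLocus_le W₁ b (K 1) s1 b1 hW₁1
    have h3 := two_mul_finrank_inf_eqLocus_le W₂ c (K 2) s2 c2 hW₂2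
    rw [finrank_top, ← hW₁] at h1
    rw [← hW₂] at h2
    rw [← hW₃] at h3
    omega
  obtain ⟨e, he, he0⟩ : ∃ e ∈ W₃, e ≠ 0 := by
    refine exists_fixed_ne_zero W₂ c (K 2) s2 hcc c2 hW₂2 (fun v hv => ?_)
      (exists_fixed_ne_zero W₁ b (K 1) s1 hbb b1 hW₁1 (fun v hv => ?_)
        (exists_fixed_ne_zero ⊤ a (K 0) s0 haa a0 (fun _ _ => trivial) (fun _ _ => trivial) ?_))
    · simp only [mem₂] at hv ⊢; rw [hac, hbc, hv.1, hv.2]; simp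
    · simp only [mem₁] at hv ⊢; rw [hab, hv]
    · simpa using exists_ne (0 : V)
  have hline : ∀ v ∈ W₃, ∃ t : ℝ, t • e = v := by
    obtain ⟨g, hg⟩ := finrank_le_one_iff.mp hfin
    obtain ⟨s, hs⟩ := hg ⟨e, he⟩
    have hs' : s • (g : V) = e := congrArg Subtype.val hs
    have hs0 : s ≠ 0 := by rintro rfl; exact he0 (by simpa using hs'.symm)
    intro v hv
    obtain ⟨t, ht⟩ := hg ⟨v, hv⟩
    have ht' : t • (g : V) = v := congrArg Subtype.val ht
    exact ⟨t * s⁻¹, by rw [← hs', ← ht', smul_smul, inv_mul_cancel_right₀ hs0]⟩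
  obtain ⟨⟨hea, heb⟩, hec⟩ := (mem₃ e).mp he
  obtain ⟨α, hα⟩ : ∃ α : ℝ, α • e = P e := by
    refine hline _ ((mem₃ _).mpr ⟨⟨?_, ?_⟩, ?_⟩)
    · rw [ha, comm, ← ha, hea]
    · rw [hb, comm, ← hb, heb]
    · rw [hc, comm, ← hc, hec]
  obtain ⟨w, hw⟩ : ∃ w, B e w ≠ 0 := by
    by_contra! h
    exact he0 (hB e h)
  have proj : ∀ d : V →ₗ[ℝ] V, (∀ v w, B (d v) w = -B v (d w)) → d e = e →
      ∀ v, B e (v - d v) = 2 * B e v := by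
    intro d hd hde v
    have := hd e v
    rw [hde] at this
    rw [map_sub]
    linarith
  let f := w - a w - b (w - a w) - c (w - a w - b (w - a w))
  have hf : B e f ≠ 0 := by
    rw [proj c (skew2 2 5 (by decide)) hec, proj b (skew2 1 4 (by decide)) heb,
      proj a (skew2 0 3 (by decide)) hea]
    simpa using hw
  have hfa : a f = -f := by simp only [f, map_sub, hab, hac, haa]; abel
  have hfb : b f = -f := by simp only [f, map_sub, hbc, hbb]; abel
  have hfc : c f = -f := by simp only [f, map_sub, hcc]; abel
  obtain ⟨t, ht⟩ : ∃ t : ℝ, t • e = K 0 (K 1 (K 2 f)) := by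
    refine hline _ ((mem₃ _).mpr ⟨⟨?_, ?_⟩, ?_⟩)
    · simp [a0, a1, a2, hfa]
    · simp [b0, b1, b2, hfb]
    · simp [c0, c1, c2, hfc]
  have hfe : f = -(t • K 0 (K 1 (K 2 e))) := by
    rw [← map_smul, ← map_smul, ← map_smul, ht]
    simp [t01, t02, t12, s0, s1, s2]
  have hPf : α • P f = -f := by
    have h : P (K 0 (K 1 (K 2 (P e)))) = -K 0 (K 1 (K 2 e)) := by rw [comm, hPK]
    rw [← hα] at h
    simp only [map_smul] at h
    rw [hfe, map_neg, map_smul, smul_neg, smul_comm, h, smul_neg]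
  have h1 : α * α * B e f = -B e f := by
    have h2 := hP e f
    rw [← hα, map_smul, LinearMap.smul_apply, smul_eq_mul] at h2
    rw [mul_assoc, h2, ← smul_eq_mul, ← map_smul, hPf, map_neg]
  have h3 : (α * α + 1) * B e f = 0 := by linarith
  rcases mul_eq_zero.mp h3 with h | h
  · nlinarith [mul_self_nonneg α]
  · exact hf h

end Clifford

theorem sform_comm (r s : ℕ) (Z W : Fin (r + s) → ℝ) : sform r s Z W = sform r s W Z :=
  Finset.sum_congr rfl fun _ _ => by ring

theorem sform_add_self (r s : ℕ) (Z W : Fin (r + s) → ℝ) :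
    sform r s (Z + W) (Z + W) = sform r s Z Z + 2 * sform r s Z W + sform r s W W := by
  simp only [sform, Finset.mul_sum, ← Finset.sum_add_distrib, Pi.add_apply]
  exact Finset.sum_congr rfl fun _ _ => by ring

theorem sform_single (r s : ℕ) (i j : Fin (r + s)) :
    sform r s (Pi.single i 1) (Pi.single j 1) =
      if i = j then (if (i : ℕ) < r then 1 else -1) else 0 := by
  simp [sform, Pi.single_apply, eq_comm (a := j)]
  grind

/-- The polarized Clifford relation. -/
theorem IsAdmissible.anticomm {r s : ℕ} {V : Type} [AddCommGroup V] [Module ℝ V]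
    {B : V →ₗ[ℝ] V →ₗ[ℝ] ℝ} {J : (Fin (r + s) → ℝ) →ₗ[ℝ] V →ₗ[ℝ] V}
    (h : IsAdmissible r s V B J) (Z W : Fin (r + s) → ℝ) (hZW : sform r s Z W = 0) (v : V) :
    J Z (J W v) = -J W (J Z v) := by
  obtain ⟨-, -, -, -, hJ, -⟩ := h
  have h := hJ (Z + W) v
  simp only [map_add, LinearMap.add_apply, hJ, sform_add_self, hZW] at h
  rw [eq_neg_iff_add_eq_zero]
  have h' : J Z (J W v) + J W (J Z v) =
      (-(sform r s Z Z) • v + J W (J Z v) + (J Z (J W v) + -(sform r s W W) • v))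
        + (sform r s Z Z + sform r s W W) • v := by module
  rw [h', h]
  module

theorem stmt16
    (V1 : Type) [AddCommGroup V1] [Module ℝ V1]
    (B1 : V1 →ₗ[ℝ] V1 →ₗ[ℝ] ℝ)
    (J1 : (Fin (3 + 3) → ℝ) →ₗ[ℝ] V1 →ₗ[ℝ] V1)
    (br1 : V1 →ₗ[ℝ] V1 →ₗ[ℝ] (Fin (3 + 3) → ℝ))
    (hadm1 : IsMinimalAdmissible 3 3 V1 B1 J1)
    (hbr1 : IsHBracket 3 3 V1 B1 J1 br1)
    :
    ¬ ∃ (φ : (V1 × (Fin (3 + 3) → ℝ)) ≃ₗ[ℝ] (V1 × (Fin (3 + 3) → ℝ)))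
        (C : (Fin (3 + 3) → ℝ) →ₗ[ℝ] (Fin (3 + 3) → ℝ)),
        IsLieIso br1 br1 φ ∧
        (∀ Z : Fin (3 + 3) → ℝ, φ (0, Z) = (0, C Z)) ∧
        Function.Surjective ⇑C ∧
        (∀ Z W : Fin (3 + 3) → ℝ, sform 3 3 (C Z) (C W) = -(sform 3 3 Z W)) := by
  rintro ⟨φ, C, hφ, hφC, -, hC⟩
  have hdim : Module.finrank ℝ V1 ≤ 8 := by
    simpa using hadm1.2 _ spinorForm spinorAction isAdmissible_spinor
  have hadm := hadm1.1
  obtain ⟨hfd, hnt, hsymm, hnd, hJ, hsk⟩ := hadm1.1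
  let A : V1 →ₗ[ℝ] V1 := LinearMap.fst ℝ V1 _ ∘ₗ φ.toLinearMap ∘ₗ LinearMap.inl ℝ V1 _
  have hbr : ∀ v w, C (br1 v w) = br1 (A v) (A w) := fun v w => by
    have h := hφ (v, 0) (w, 0)
    rw [hφC] at h
    exact congrArg Prod.snd h
  have hA : ∀ Z v w, B1 (J1 (C Z) (A v)) (A w) = -B1 (J1 Z v) w := fun Z v w => by
    rw [← hbr1, ← hbr1, ← hbr, hC]
  have hBnd : LinearMap.BilinForm.Nondegenerate B1 :=
    ⟨hnd, fun v h => hnd v fun w => (hsymm v w).trans (h w)⟩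
  let A' : V1 →ₗ[ℝ] V1 := LinearMap.BilinForm.leftAdjointOfNondegenerate B1 hBnd A
  have hA' : ∀ v w, B1 (A' v) w = B1 v (A w) :=
    LinearMap.BilinForm.isAdjointPairLeftAdjointOfNondegenerate B1 hBnd A
  have hAJ : ∀ Z v, A' (J1 (C Z) (A v)) = -J1 Z v := fun Z v => by
    rw [← sub_eq_zero]
    refine hnd _ fun w => ?_
    rw [map_sub, LinearMap.sub_apply, hA', hA, map_neg, LinearMap.neg_apply, sub_self]
  have hsq : ∀ Z v, A' (J1 (C Z) (A (A' (J1 (C Z) (A v))))) = -(sform 3 3 Z Z) • v :=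
    fun Z v => by simp [hAJ, hJ]
  have hinj : Function.Injective A := by
    rw [injective_iff_map_eq_zero]
    intro v hv
    have h := hsq (Pi.single 0 1) v
    rw [sform_single, hv] at h
    simpa using h
  have hsurj : Function.Surjective A := LinearMap.injective_iff_surjective.mp hinj
  have hPJ : ∀ Z, sform 3 3 Z Z ≠ 0 → ∀ v, A (A' (J1 (C Z) (A (A' v)))) = -J1 (C Z) v := by
    intro Z hZ v
    obtain ⟨u, hu⟩ := hsurj (J1 (C Z) v)
    have h := congrArg A (hsq Z u)
    rw [hu, hJ, hC, neg_neg, map_smul, map_smul, map_smul, map_smul, map_smul, map_smul, hu,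
      neg_smul, ← smul_neg] at h
    exact smul_right_injective _ hZ h
  have hCs : ∀ i j, sform 3 3 (C (Pi.single i 1)) (C (Pi.single j 1)) =
      -if i = j then (if (i : ℕ) < 3 then 1 else -1) else 0 := fun i j => by
    rw [hC, sform_single]
  refine clifford_no_twist hdim B1 hnd (fun i => J1 (C (Pi.single i 1))) ?_ ?_ ?_
    (fun i => hsk _) (A ∘ₗ A') ?_ ?_
  · intro i j hij v
    exact hadm.anticomm _ _ (by rw [hCs, if_neg hij.ne', neg_zero]) v
  · intro i hi v
    have hi' : (i : ℕ) < 3 := hi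
    rw [hJ, hCs, if_pos rfl, if_pos hi', neg_neg, one_smul]
  · intro i hi v
    have hi' : ¬ (i : ℕ) < 3 := not_lt.mpr hi
    rw [hJ, hCs, if_pos rfl, if_neg hi', neg_neg, neg_one_smul]
  · intro v w
    simp only [LinearMap.comp_apply]
    rw [hsymm, ← hA', hsymm, hA']
  · intro i v
    refine hPJ _ ?_ v
    rw [sform_single, if_pos rfl]
    split_ifs <;> norm_num
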